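/- arXiv:2602.02403 — 3 statements merged into one kernel-verified Lean document; each statement's English description precedes it below -/
import Mathlib

section
/- Let n_T, n_S ∈ ℕ. Let G_T be an n_T×n_T real symmetric matrix with nonnegative entries and zero diagonal, G_S an n_S×n_S real symmetric matrix with nonnegative entries and zero diagonal, G_TS an n_T×n_S matrix with entries in {0,1} having at most one nonzero entry in each row and in each column, and G_ST = G_TSᵀ. Let λ_T ≥ 0, λ_S ≥ 0 and β ∈ (−1,1) satisfy max(λ_T·‖G_T‖, λ_S·‖G_S‖) < 1 − |β|, where ‖·‖ denotes the ℓ² operator norm. Then for every α^T ∈ ℝ^{n_T} and α^S ∈ ℝ^{n_S}, the game of the previous setting has a unique Nash equilibrium (t*, s*), given by (t*, s*) = M⁻¹·(α^T, α^S), where M = fromBlocks(I_{n_T} − λ_T G_T, β G_TS, β G_ST, I_{n_S} − λ_S G_S). -/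
open Matrix

/-- The ℓ² operator norm of a real matrix: the norm of the induced linear map
between Euclidean spaces. -/
noncomputable def l2OpNorm {m n : Type*} [Fintype m] [Fintype n] [DecidableEq n]
    (A : Matrix m n ℝ) : ℝ :=
  ‖LinearMap.toContinuousLinearMap (Matrix.toEuclideanLin A)‖

/-- The payoff of inventor coordinate `i` in the two-network peer-effect game. -/
noncomputable def inventorPayoff {nT nS : ℕ} (GT : Matrix (Fin nT) (Fin nT) ℝ)
    (GTS : Matrix (Fin nT) (Fin nS) ℝ) (lamT beta : ℝ) (alphaT : Fin nT → ℝ)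
    (t : Fin nT → ℝ) (s : Fin nS → ℝ) (i : Fin nT) : ℝ :=
  alphaT i * t i - (1/2) * t i ^ 2 - beta * t i * (GTS *ᵥ s) i + lamT * t i * (GT *ᵥ t) i

/-- The payoff of scientist coordinate `j` in the two-network peer-effect game,
with `G_ST = G_TSᵀ`. -/
noncomputable def scientistPayoff {nT nS : ℕ} (GS : Matrix (Fin nS) (Fin nS) ℝ)
    (GTS : Matrix (Fin nT) (Fin nS) ℝ) (lamS beta : ℝ) (alphaS : Fin nS → ℝ)
    (t : Fin nT → ℝ) (s : Fin nS → ℝ) (j : Fin nS) : ℝ :=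
  alphaS j * s j - (1/2) * s j ^ 2 - beta * s j * (GTSᵀ *ᵥ t) j + lamS * s j * (GS *ᵥ s) j

/-- `(t, s)` is a Nash equilibrium: each coordinate maximizes its own payoff given
all the other coordinates. -/
def IsNashEquilibrium {nT nS : ℕ} (GT : Matrix (Fin nT) (Fin nT) ℝ)
    (GS : Matrix (Fin nS) (Fin nS) ℝ) (GTS : Matrix (Fin nT) (Fin nS) ℝ)
    (lamT lamS beta : ℝ) (alphaT : Fin nT → ℝ) (alphaS : Fin nS → ℝ)
    (t : Fin nT → ℝ) (s : Fin nS → ℝ) : Prop :=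
  (∀ i : Fin nT, ∀ x : ℝ,
      inventorPayoff GT GTS lamT beta alphaT (Function.update t i x) s i ≤
        inventorPayoff GT GTS lamT beta alphaT t s i) ∧
  (∀ j : Fin nS, ∀ x : ℝ,
      scientistPayoff GS GTS lamS beta alphaS t (Function.update s j x) j ≤
        scientistPayoff GS GTS lamS beta alphaS t s j)


lemma aux_foc (c t : ℝ) : (∀ x : ℝ, c * x - (1/2) * x ^ 2 ≤ c * t - (1/2) * t ^ 2) ↔ t = c := by
  constructor
  · intro h
    have := h c
    have h2 : (t - c) ^ 2 ≤ 0 := by nlinarith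
    have h3 : t - c = 0 := by
      have := le_antisymm h2 (sq_nonneg _)
      exact pow_eq_zero_iff (two_ne_zero) |>.1 this
    linarith
  · rintro rfl x
    nlinarith [sq_nonneg (x - t)]

lemma aux_update {n : ℕ} (G : Matrix (Fin n) (Fin n) ℝ) (hd : ∀ i, G i i = 0)
    (t : Fin n → ℝ) (i : Fin n) (x : ℝ) :
    (G *ᵥ Function.update t i x) i = (G *ᵥ t) i := by
  simp only [Matrix.mulVec, dotProduct]
  refine Finset.sum_congr rfl fun j _ => ?_
  by_cases h : j = i
  · subst h; simp [hd]
  · rw [Function.update_of_ne h]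

lemma aux_nash_iff {nT nS : ℕ} (GT : Matrix (Fin nT) (Fin nT) ℝ) (hGTdiag : ∀ i, GT i i = 0)
    (GS : Matrix (Fin nS) (Fin nS) ℝ) (hGSdiag : ∀ j, GS j j = 0)
    (GTS : Matrix (Fin nT) (Fin nS) ℝ) (lamT lamS beta : ℝ)
    (alphaT : Fin nT → ℝ) (alphaS : Fin nS → ℝ) (t : Fin nT → ℝ) (s : Fin nS → ℝ) :
    IsNashEquilibrium GT GS GTS lamT lamS beta alphaT alphaS t s ↔
      (fromBlocks (1 - lamT • GT) (beta • GTS) (beta • GTSᵀ) (1 - lamS • GS)) *ᵥ Sum.elim t s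
        = Sum.elim alphaT alphaS := by
  have h1 : ∀ i, (∀ x : ℝ, inventorPayoff GT GTS lamT beta alphaT (Function.update t i x) s i ≤
        inventorPayoff GT GTS lamT beta alphaT t s i) ↔
        t i = alphaT i - beta * (GTS *ᵥ s) i + lamT * (GT *ᵥ t) i := by
    intro i
    rw [← aux_foc]
    refine forall_congr' fun x => ?_
    unfold inventorPayoff
    rw [aux_update GT hGTdiag, Function.update_self]
    ring_nf
  have h2 : ∀ j, (∀ x : ℝ, scientistPayoff GS GTS lamS beta alphaS t (Function.update s j x) j ≤
        scientistPayoff GS GTS lamS beta alphaS t s j) ↔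
        s j = alphaS j - beta * (GTSᵀ *ᵥ t) j + lamS * (GS *ᵥ s) j := by
    intro i
    rw [← aux_foc]
    refine forall_congr' fun x => ?_
    unfold scientistPayoff
    rw [aux_update GS hGSdiag, Function.update_self]
    ring_nf
  unfold IsNashEquilibrium
  simp only [h1, h2]
  rw [fromBlocks_mulVec, funext_iff, Sum.forall]
  simp only [Sum.elim_inl, Sum.elim_inr, Sum.elim_comp_inl, Sum.elim_comp_inr, Pi.add_apply,
    sub_mulVec, one_mulVec, smul_mulVec, Pi.sub_apply, Pi.smul_apply, smul_eq_mul]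
  refine and_congr (forall_congr' fun i => ?_) (forall_congr' fun i => ?_) <;>
    constructor <;> intro h <;> linarith

lemma aux_quad {n : ℕ} (G : Matrix (Fin n) (Fin n) ℝ) (t : Fin n → ℝ) :
    t ⬝ᵥ (G *ᵥ t) ≤ l2OpNorm G * (t ⬝ᵥ t) := by
  set L := LinearMap.toContinuousLinearMap (Matrix.toEuclideanLin G) with hL
  set v : EuclideanSpace ℝ (Fin n) := WithLp.toLp 2 t
  have e1 : inner ℝ v (L v) = t ⬝ᵥ (G *ᵥ t) := by
    simp [hL, v, PiLp.inner_apply, dotProduct, Matrix.toLpLin_toLp, mul_comm]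
  have e2 : ‖v‖ * ‖v‖ = t ⬝ᵥ t := by
    rw [← real_inner_self_eq_norm_mul_norm, PiLp.inner_apply]
    rfl
  rw [← e1, ← e2]
  calc inner ℝ v (L v) ≤ ‖v‖ * ‖L v‖ := real_inner_le_norm _ _
    _ ≤ ‖v‖ * (‖L‖ * ‖v‖) := by gcongr; exact L.le_opNorm v
    _ = l2OpNorm G * (‖v‖ * ‖v‖) := by unfold l2OpNorm; rw [← hL]; ring

lemma aux_sum_le_one {n : ℕ} (f : Fin n → ℝ) (h01 : ∀ j, f j = 0 ∨ f j = 1)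
    (h : {j | f j ≠ 0}.Subsingleton) : ∑ j, f j ≤ 1 := by
  by_cases hz : ∃ j, f j ≠ 0
  · obtain ⟨j, hj⟩ := hz
    rw [Finset.sum_eq_single j]
    · rcases h01 j with h | h <;> simp [h]
    · intro k _ hk
      by_contra hne
      exact hk (h hne hj)
    · simp
  · push Not at hz
    simp [hz]

lemma aux_cross {nT nS : ℕ} (GTS : Matrix (Fin nT) (Fin nS) ℝ)
    (hGTS01 : ∀ i j, GTS i j = 0 ∨ GTS i j = 1)
    (hGTSrow : ∀ i, {j | GTS i j ≠ 0}.Subsingleton)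
    (hGTScol : ∀ j, {i | GTS i j ≠ 0}.Subsingleton) (t : Fin nT → ℝ) (s : Fin nS → ℝ) :
    2 * |t ⬝ᵥ (GTS *ᵥ s)| ≤ t ⬝ᵥ t + s ⬝ᵥ s := by
  have hnn : ∀ i j, 0 ≤ GTS i j := fun i j => by rcases hGTS01 i j with h | h <;> simp [h]
  have e : t ⬝ᵥ (GTS *ᵥ s) = ∑ i, ∑ j, GTS i j * (t i * s j) := by
    simp only [Matrix.mulVec, dotProduct, Finset.mul_sum]
    exact Finset.sum_congr rfl fun i _ => Finset.sum_congr rfl fun j _ => by ring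
  have hb : 2 * |t ⬝ᵥ (GTS *ᵥ s)| ≤ ∑ i, ∑ j, (GTS i j * t i ^ 2 + GTS i j * s j ^ 2) := by
    rw [e]
    calc 2 * |∑ i, ∑ j, GTS i j * (t i * s j)|
        ≤ 2 * ∑ i, ∑ j, |GTS i j * (t i * s j)| := by
          gcongr
          refine (Finset.abs_sum_le_sum_abs _ _).trans ?_
          exact Finset.sum_le_sum fun i _ => Finset.abs_sum_le_sum_abs _ _
      _ ≤ _ := by
          simp only [Finset.mul_sum]
          refine Finset.sum_le_sum fun i _ => Finset.sum_le_sum fun j _ => ?_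
          rw [abs_mul, abs_of_nonneg (hnn i j), abs_mul]
          have := two_mul_le_add_sq |t i| |s j|
          rw [sq_abs, sq_abs] at this
          nlinarith [hnn i j]
  refine hb.trans ?_
  simp only [Finset.sum_add_distrib]
  refine add_le_add ?_ ?_
  · refine Finset.sum_le_sum fun i _ => ?_
    rw [← Finset.sum_mul]
    have := aux_sum_le_one (fun j => GTS i j) (hGTS01 i) (hGTSrow i)
    nlinarith [sq_nonneg (t i)]
  · rw [Finset.sum_comm]
    refine Finset.sum_le_sum fun j _ => ?_
    rw [← Finset.sum_mul]
    have := aux_sum_le_one (fun i => GTS i j) (fun i => hGTS01 i j) (hGTScol j)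
    nlinarith [sq_nonneg (s j)]

/-- Proposition 1 of the paper: under Assumption 1
(`max(λ_T‖G_T‖, λ_S‖G_S‖) < 1 − |β|`), for every `α^T, α^S` the two-network
peer-effect game has a unique Nash equilibrium, given by
`(t*, s*) = M⁻¹ (α^T, α^S)` with
`M = fromBlocks (I − λ_T G_T) (β G_TS) (β G_ST) (I − λ_S G_S)`. -/
theorem unique_nash_equilibrium
    (nT nS : ℕ)
    (GT : Matrix (Fin nT) (Fin nT) ℝ) (hGTsym : GT.IsSymm)
    (hGTpos : ∀ i j, 0 ≤ GT i j) (hGTdiag : ∀ i, GT i i = 0)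
    (GS : Matrix (Fin nS) (Fin nS) ℝ) (hGSsym : GS.IsSymm)
    (hGSpos : ∀ i j, 0 ≤ GS i j) (hGSdiag : ∀ j, GS j j = 0)
    (GTS : Matrix (Fin nT) (Fin nS) ℝ)
    (hGTS01 : ∀ i j, GTS i j = 0 ∨ GTS i j = 1)
    (hGTSrow : ∀ i, {j | GTS i j ≠ 0}.Subsingleton)
    (hGTScol : ∀ j, {i | GTS i j ≠ 0}.Subsingleton)
    (lamT lamS beta : ℝ) (hlamT : 0 ≤ lamT) (hlamS : 0 ≤ lamS) (hbeta : |beta| < 1)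
    (hnet : max (lamT * l2OpNorm GT) (lamS * l2OpNorm GS) < 1 - |beta|)
    (alphaT : Fin nT → ℝ) (alphaS : Fin nS → ℝ) :
    (∃! p : (Fin nT → ℝ) × (Fin nS → ℝ),
        IsNashEquilibrium GT GS GTS lamT lamS beta alphaT alphaS p.1 p.2) ∧
    (∀ p : (Fin nT → ℝ) × (Fin nS → ℝ),
        IsNashEquilibrium GT GS GTS lamT lamS beta alphaT alphaS p.1 p.2 →
        Sum.elim p.1 p.2 =
          (fromBlocks (1 - lamT • GT) (beta • GTS) (beta • GTSᵀ) (1 - lamS • GS))⁻¹ *ᵥ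
            Sum.elim alphaT alphaS) := by
  set M := fromBlocks (1 - lamT • GT) (beta • GTS) (beta • GTSᵀ) (1 - lamS • GS) with hM
  have hinj : ∀ v, M *ᵥ v = 0 → v = 0 := by
    intro v hv
    obtain ⟨t, s, rfl⟩ : ∃ t s, v = Sum.elim t s :=
      ⟨v ∘ Sum.inl, v ∘ Sum.inr, (Sum.elim_comp_inl_inr v).symm⟩
    have hq : Sum.elim t s ⬝ᵥ (M *ᵥ Sum.elim t s) = 0 := by rw [hv, dotProduct_zero]
    have hc : s ⬝ᵥ (GTSᵀ *ᵥ t) = t ⬝ᵥ (GTS *ᵥ s) := by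
      rw [mulVec_transpose, dotProduct_comm, dotProduct_mulVec]
    rw [hM, fromBlocks_mulVec, sumElim_dotProduct_sumElim] at hq
    simp only [Sum.elim_comp_inl, Sum.elim_comp_inr, sub_mulVec, one_mulVec, smul_mulVec,
      dotProduct_add, dotProduct_sub, dotProduct_smul, smul_eq_mul, hc] at hq
    have hT := mul_le_mul_of_nonneg_left (aux_quad GT t) hlamT
    have hS := mul_le_mul_of_nonneg_left (aux_quad GS s) hlamS
    have hX := aux_cross GTS hGTS01 hGTSrow hGTScol t s
    have hX' := mul_le_mul_of_nonneg_left hX (abs_nonneg beta)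
    have hb : -(|beta| * |t ⬝ᵥ (GTS *ᵥ s)|) ≤ beta * (t ⬝ᵥ (GTS *ᵥ s)) := by
      rw [← abs_mul]; exact neg_abs_le _
    obtain ⟨hn1, hn2⟩ := max_lt_iff.1 hnet
    have ht0 : 0 ≤ t ⬝ᵥ t := Finset.sum_nonneg fun i _ => mul_self_nonneg _
    have hs0 : 0 ≤ s ⬝ᵥ s := Finset.sum_nonneg fun i _ => mul_self_nonneg _
    have key : (1 - |beta| - lamT * l2OpNorm GT) * (t ⬝ᵥ t) +
        (1 - |beta| - lamS * l2OpNorm GS) * (s ⬝ᵥ s) ≤ 0 := by linarith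
    have p1 := mul_nonneg (sub_pos.2 hn1).le ht0
    have p2 := mul_nonneg (sub_pos.2 hn2).le hs0
    have z1 : t ⬝ᵥ t = 0 :=
      (mul_eq_zero.1 (le_antisymm (by linarith) p1)).resolve_left (sub_pos.2 hn1).ne'
    have z2 : s ⬝ᵥ s = 0 :=
      (mul_eq_zero.1 (le_antisymm (by linarith) p2)).resolve_left (sub_pos.2 hn2).ne'
    rw [dotProduct_self_eq_zero] at z1 z2
    subst z1 z2
    ext (i | i) <;> rfl
  have hdet : IsUnit M.det := by
    rw [isUnit_iff_ne_zero]
    intro h0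
    obtain ⟨v, hv, hv0⟩ := exists_mulVec_eq_zero_iff.2 h0
    exact hv (hinj v hv0)
  have huniq : ∀ p : (Fin nT → ℝ) × (Fin nS → ℝ),
      IsNashEquilibrium GT GS GTS lamT lamS beta alphaT alphaS p.1 p.2 →
        Sum.elim p.1 p.2 = M⁻¹ *ᵥ Sum.elim alphaT alphaS := by
    intro p hp
    rw [aux_nash_iff GT hGTdiag GS hGSdiag] at hp
    rw [← hp, mulVec_mulVec, nonsing_inv_mul _ hdet, one_mulVec]
  refine ⟨⟨((M⁻¹ *ᵥ Sum.elim alphaT alphaS) ∘ Sum.inl, (M⁻¹ *ᵥ Sum.elim alphaT alphaS) ∘ Sum.inr),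
    ?_, ?_⟩, huniq⟩
  · show IsNashEquilibrium _ _ _ _ _ _ _ _ _ _
    rw [aux_nash_iff GT hGTdiag GS hGSdiag, Sum.elim_comp_inl_inr, ← hM, mulVec_mulVec,
      mul_nonsing_inv _ hdet, one_mulVec]
  · intro p hp
    rw [← huniq p hp]
    rfl
end

section
/- Let n_T, n_S ∈ ℕ. Let G_T be an n_T×n_T real symmetric matrix with nonnegative entries, G_S an n_S×n_S real symmetric matrix with nonnegative entries, G_TS an n_T×n_S matrix with entries in {0,1} having at most one nonzero entry in each row and in each column, and G_ST = G_TSᵀ. Let λ_T ≥ 0, λ_S ≥ 0 and β ∈ (−1,1) satisfy max(λ_T·‖G_T‖, λ_S·‖G_S‖) < 1 − |β|, where ‖·‖ denotes the ℓ² operator norm. Set A = fromBlocks(λ_T G_T, −β G_TS, −β G_ST, λ_S G_S). Then ‖A‖ ≤ max(λ_T·‖G_T‖, λ_S·‖G_S‖) + |β| < 1, and the matrix M = I_{n_T+n_S} − A = fromBlocks(I_{n_T} − λ_T G_T, β G_TS, β G_ST, I_{n_S} − λ_S G_S) is invertible. -/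
open Matrix

theorem l2aux_le {m n : Type*} [Fintype m] [Fintype n] [DecidableEq n]
    (A : Matrix m n ℝ) (c : ℝ) (hc : 0 ≤ c)
    (h : ∀ x : n → ℝ, ∑ i, (A *ᵥ x) i ^ 2 ≤ c ^ 2 * ∑ j, x j ^ 2) : l2OpNorm A ≤ c := by
  unfold l2OpNorm
  refine ContinuousLinearMap.opNorm_le_bound _ hc fun x => ?_
  refine (sq_le_sq₀ (norm_nonneg _) (mul_nonneg hc (norm_nonneg _))).1 ?_
  rw [mul_pow, EuclideanSpace.real_norm_sq_eq, EuclideanSpace.real_norm_sq_eq]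
  exact h x.ofLp

theorem l2aux_bound {m n : Type*} [Fintype m] [Fintype n] [DecidableEq n]
    (A : Matrix m n ℝ) (x : n → ℝ) :
    ∑ i, (A *ᵥ x) i ^ 2 ≤ l2OpNorm A ^ 2 * ∑ j, x j ^ 2 := by
  have h := (LinearMap.toContinuousLinearMap (Matrix.toEuclideanLin A)).le_opNorm
    (WithLp.toLp 2 x)
  have h2 := pow_le_pow_left₀ (norm_nonneg _) h 2
  rw [mul_pow, EuclideanSpace.real_norm_sq_eq, EuclideanSpace.real_norm_sq_eq] at h2
  exact h2

theorem sum01_le {n : Type*} [Fintype n] (f : n → ℝ) (h01 : ∀ j, f j = 0 ∨ f j = 1)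
    (hs : {j | f j ≠ 0}.Subsingleton) : ∑ j, f j ≤ 1 := by
  classical
  by_cases h : ∃ j, f j ≠ 0
  · obtain ⟨j, hj⟩ := h
    rw [Finset.sum_eq_single j]
    · rcases h01 j with h | h <;> simp [h]
    · intro b _ hb
      by_contra hne
      exact hb (hs hne hj)
    · simp
  · push Not at h
    simp [h]

theorem matching_bound {m n : Type*} [Fintype m] [Fintype n]
    (B : Matrix m n ℝ) (h01 : ∀ i j, B i j = 0 ∨ B i j = 1)
    (hrow : ∀ i, {j | B i j ≠ 0}.Subsingleton)
    (hcol : ∀ j, {i | B i j ≠ 0}.Subsingleton) (x : n → ℝ) :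
    ∑ i, (B *ᵥ x) i ^ 2 ≤ ∑ j, x j ^ 2 := by
  have hsq : ∀ i j, B i j ^ 2 = B i j := fun i j => by rcases h01 i j with h | h <;> simp [h]
  have hnn : ∀ i j, 0 ≤ B i j := fun i j => by rcases h01 i j with h | h <;> simp [h]
  have h1 : ∀ i, (B *ᵥ x) i ^ 2 ≤ ∑ j, B i j * x j ^ 2 := by
    intro i
    have h := Finset.sum_mul_sq_le_sq_mul_sq Finset.univ (fun j => B i j) (fun j => B i j * x j)
    simp only [mul_pow, hsq, ← mul_assoc, ← sq] at h
    have h2 : 0 ≤ ∑ j, B i j * x j ^ 2 :=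
      Finset.sum_nonneg fun j _ => mul_nonneg (hnn i j) (sq_nonneg _)
    have h3 := sum01_le (fun j => B i j) (h01 i) (hrow i)
    calc (B *ᵥ x) i ^ 2 = (∑ j, B i j * x j) ^ 2 := rfl
      _ ≤ _ := h
      _ ≤ 1 * ∑ j, B i j * x j ^ 2 := mul_le_mul_of_nonneg_right h3 h2
      _ = _ := one_mul _
  calc _ ≤ ∑ i, ∑ j, B i j * x j ^ 2 := Finset.sum_le_sum fun i _ => h1 i
    _ = ∑ j, (∑ i, B i j) * x j ^ 2 := by
      rw [Finset.sum_comm]; simp only [Finset.sum_mul]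
    _ ≤ ∑ j, 1 * x j ^ 2 := Finset.sum_le_sum fun j _ =>
      mul_le_mul_of_nonneg_right (sum01_le (fun i => B i j) (fun i => h01 i j) (hcol j))
        (sq_nonneg _)
    _ = _ := by simp

theorem l2aux_add {m n : Type*} [Fintype m] [Fintype n] [DecidableEq n]
    (A B : Matrix m n ℝ) : l2OpNorm (A + B) ≤ l2OpNorm A + l2OpNorm B := by
  unfold l2OpNorm
  rw [map_add, map_add]
  exact norm_add_le _ _

open scoped Matrix.Norms.L2Operator in
theorem l2aux_unit {n : Type*} [Fintype n] [DecidableEq n]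
    (A : Matrix n n ℝ) (h : l2OpNorm A < 1) : IsUnit (1 - A) := by
  have h' : ‖A‖ < 1 := h
  haveI : CompleteSpace (Matrix n n ℝ) := FiniteDimensional.complete ℝ _
  exact isUnit_one_sub_of_norm_lt_one h'

/-- Key step in the proof of Proposition 1: under Assumption 1
(`max(λ_T‖G_T‖, λ_S‖G_S‖) < 1 − |β|`), the block interaction matrix
`A = fromBlocks (λ_T G_T) (−β G_TS) (−β G_ST) (λ_S G_S)` satisfies
`‖A‖ ≤ max(λ_T‖G_T‖, λ_S‖G_S‖) + |β| < 1`, and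
`M = I − A = fromBlocks (I − λ_T G_T) (β G_TS) (β G_ST) (I − λ_S G_S)` is invertible. -/
theorem block_interaction_matrix_invertible
    (nT nS : ℕ)
    (GT : Matrix (Fin nT) (Fin nT) ℝ) (hGTsym : GT.IsSymm) (hGTpos : ∀ i j, 0 ≤ GT i j)
    (GS : Matrix (Fin nS) (Fin nS) ℝ) (hGSsym : GS.IsSymm) (hGSpos : ∀ i j, 0 ≤ GS i j)
    (GTS : Matrix (Fin nT) (Fin nS) ℝ)
    (hGTS01 : ∀ i j, GTS i j = 0 ∨ GTS i j = 1)
    (hGTSrow : ∀ i, {j | GTS i j ≠ 0}.Subsingleton)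
    (hGTScol : ∀ j, {i | GTS i j ≠ 0}.Subsingleton)
    (lamT lamS beta : ℝ) (hlamT : 0 ≤ lamT) (hlamS : 0 ≤ lamS) (hbeta : |beta| < 1)
    (hnet : max (lamT * l2OpNorm GT) (lamS * l2OpNorm GS) < 1 - |beta|) :
    l2OpNorm (fromBlocks (lamT • GT) ((-beta) • GTS) ((-beta) • GTSᵀ) (lamS • GS)) ≤
        max (lamT * l2OpNorm GT) (lamS * l2OpNorm GS) + |beta| ∧
    max (lamT * l2OpNorm GT) (lamS * l2OpNorm GS) + |beta| < 1 ∧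
    (1 : Matrix (Fin nT ⊕ Fin nS) (Fin nT ⊕ Fin nS) ℝ) -
        fromBlocks (lamT • GT) ((-beta) • GTS) ((-beta) • GTSᵀ) (lamS • GS) =
      fromBlocks (1 - lamT • GT) (beta • GTS) (beta • GTSᵀ) (1 - lamS • GS) ∧
    IsUnit ((1 : Matrix (Fin nT ⊕ Fin nS) (Fin nT ⊕ Fin nS) ℝ) -
        fromBlocks (lamT • GT) ((-beta) • GTS) ((-beta) • GTSᵀ) (lamS • GS)) := by
  have hlt : max (lamT * l2OpNorm GT) (lamS * l2OpNorm GS) + |beta| < 1 := by linarith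
  have hT0 : 0 ≤ lamT * l2OpNorm GT := mul_nonneg hlamT (norm_nonneg _)
  have hS0 : 0 ≤ lamS * l2OpNorm GS := mul_nonneg hlamS (norm_nonneg _)
  have hle : l2OpNorm (fromBlocks (lamT • GT) ((-beta) • GTS) ((-beta) • GTSᵀ) (lamS • GS)) ≤
      max (lamT * l2OpNorm GT) (lamS * l2OpNorm GS) + |beta| := by
    have hdec : fromBlocks (lamT • GT) ((-beta) • GTS) ((-beta) • GTSᵀ) (lamS • GS) =
        fromBlocks (lamT • GT) 0 0 (lamS • GS) +
          fromBlocks 0 ((-beta) • GTS) ((-beta) • GTSᵀ) 0 := by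
      simp [fromBlocks_add]
    rw [hdec]
    refine (l2aux_add _ _).trans (add_le_add ?_ ?_)
    · refine l2aux_le _ _ (le_max_of_le_left hT0) fun x => ?_
      have e1 := l2aux_bound GT (x ∘ Sum.inl)
      have e2 := l2aux_bound GS (x ∘ Sum.inr)
      have m1 := pow_le_pow_left₀ hT0 (le_max_left _ (lamS * l2OpNorm GS)) 2
      have m2 := pow_le_pow_left₀ hS0 (le_max_right (lamT * l2OpNorm GT) _) 2
      rw [fromBlocks_mulVec]
      simp only [Fintype.sum_sum_type, Sum.elim_inl, Sum.elim_inr, zero_mulVec, add_zero,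
        zero_add, smul_mulVec, Pi.smul_apply, smul_eq_mul, mul_pow, ← Finset.mul_sum, mul_add]
      simp only [mul_pow] at m1 m2
      refine add_le_add ?_ ?_
      · refine (mul_le_mul_of_nonneg_left e1 (sq_nonneg _)).trans ?_
        rw [← mul_assoc]
        exact mul_le_mul_of_nonneg_right m1 (Finset.sum_nonneg fun _ _ => sq_nonneg _)
      · refine (mul_le_mul_of_nonneg_left e2 (sq_nonneg _)).trans ?_
        rw [← mul_assoc]
        exact mul_le_mul_of_nonneg_right m2 (Finset.sum_nonneg fun _ _ => sq_nonneg _)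
    · refine l2aux_le _ _ (abs_nonneg _) fun x => ?_
      have e1 := matching_bound GTS hGTS01 hGTSrow hGTScol (x ∘ Sum.inr)
      have e2 := matching_bound GTSᵀ (fun i j => hGTS01 j i) hGTScol hGTSrow (x ∘ Sum.inl)
      rw [fromBlocks_mulVec]
      simp only [Fintype.sum_sum_type, Sum.elim_inl, Sum.elim_inr, zero_mulVec, add_zero,
        zero_add, smul_mulVec, Pi.smul_apply, smul_eq_mul, mul_pow, ← Finset.mul_sum, mul_add,
        sq_abs, neg_sq]
      rw [add_comm]
      exact add_le_add (mul_le_mul_of_nonneg_left e2 (sq_nonneg _))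
        (mul_le_mul_of_nonneg_left e1 (sq_nonneg _))
  refine ⟨hle, hlt, ?_, l2aux_unit _ (hle.trans_lt hlt)⟩
  rw [← fromBlocks_one, sub_eq_add_neg, fromBlocks_neg, fromBlocks_add]
  simp [sub_eq_add_neg]
end

section
/- Let n_T, n_S ∈ ℕ, let G_T be an n_T×n_T real symmetric matrix with nonnegative entries, G_S an n_S×n_S real symmetric matrix with nonnegative entries, G_TS an n_T×n_S matrix with entries in {0,1} having at most one nonzero entry in each row and in each column, and G_ST = G_TSᵀ. Let λ_T ≥ 0, λ_S ≥ 0 and β ∈ (−1,1) satisfy max(2λ_T·‖G_T‖, 2λ_S·‖G_S‖) < 1 − |β|, where ‖·‖ denotes the ℓ² operator norm, and let α^T ∈ ℝ^{n_T}, α^S ∈ ℝ^{n_S}. Define W(t,s) = ⟨α^T, t⟩ + ⟨α^S, s⟩ − (1/2)‖t‖₂² − (1/2)‖s‖₂² − β·⟨t, G_TS s⟩ + λ_T·⟨t, G_T t⟩ + λ_S·⟨s, G_S s⟩. Then W is strictly concave on ℝ^{n_T} × ℝ^{n_S}, the block matrix M₂ = fromBlocks(I_{n_T} − 2λ_T G_T,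 β G_TS, β G_ST, I_{n_S} − 2λ_S G_S) is invertible, and W attains its unique global maximum at the point (t°, s°) = M₂⁻¹·(α^T, α^S). -/
open Matrix

lemma aux_norm {n : ℕ} (A : Matrix (Fin n) (Fin n) ℝ) (u : Fin n → ℝ) :
    u ⬝ᵥ (A *ᵥ u) ≤ l2OpNorm A * (u ⬝ᵥ u) := by
  have h1 := (LinearMap.toContinuousLinearMap (Matrix.toEuclideanLin A)).le_opNorm (WithLp.toLp 2 u)
  have h2 := real_inner_le_norm (WithLp.toLp 2 u)
    ((LinearMap.toContinuousLinearMap (Matrix.toEuclideanLin A)) (WithLp.toLp 2 u))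
  have h3 : inner ℝ (WithLp.toLp 2 u)
    ((LinearMap.toContinuousLinearMap (Matrix.toEuclideanLin A)) (WithLp.toLp 2 u))
      = u ⬝ᵥ (A *ᵥ u) := by
    simp [PiLp.inner_apply, dotProduct, mul_comm]
  have h4 : ‖WithLp.toLp 2 u‖ * ‖WithLp.toLp 2 u‖ = u ⬝ᵥ u := by
    rw [← real_inner_self_eq_norm_mul_norm, PiLp.inner_apply]
    simp [dotProduct, pow_two]
  rw [h3] at h2
  have h5 := mul_le_mul_of_nonneg_left h1 (norm_nonneg (WithLp.toLp 2 u))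
  unfold l2OpNorm
  rw [← h4]
  linarith

lemma aux_row {n : ℕ} (g : Fin n → ℝ) (h01 : ∀ j, g j = 0 ∨ g j = 1)
    (hs : {j | g j ≠ 0}.Subsingleton) : ∑ j, g j ≤ 1 := by
  by_cases h : ∃ j, g j ≠ 0
  · obtain ⟨j, hj⟩ := h
    rw [Finset.sum_eq_single j]
    · rcases h01 j with h | h <;> rw [h]
      norm_num
    · intro b _ hb
      by_contra hc
      exact hb (hs hc hj)
    · simp
  · push Not at h
    simp [h]

lemma aux_cross_s9 {m n : ℕ} (G : Matrix (Fin m) (Fin n) ℝ)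
    (h01 : ∀ i j, G i j = 0 ∨ G i j = 1)
    (hrow : ∀ i, {j | G i j ≠ 0}.Subsingleton)
    (hcol : ∀ j, {i | G i j ≠ 0}.Subsingleton) (u : Fin m → ℝ) (v : Fin n → ℝ) :
    |u ⬝ᵥ (G *ᵥ v)| ≤ (u ⬝ᵥ u + v ⬝ᵥ v) / 2 := by
  have e : u ⬝ᵥ (G *ᵥ v) = ∑ i, ∑ j, G i j * (u i * v j) := by
    simp only [dotProduct, mulVec, Finset.mul_sum]
    exact Finset.sum_congr rfl fun i _ => Finset.sum_congr rfl fun j _ => by ring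
  have h0 : ∀ i j, 0 ≤ G i j := fun i j => by rcases h01 i j with h | h <;> rw [h]; norm_num
  have b : |u ⬝ᵥ (G *ᵥ v)| ≤ ∑ i, ∑ j, (G i j * (u i * u i / 2) + G i j * (v j * v j / 2)) := by
    rw [e]
    refine (Finset.abs_sum_le_sum_abs _ _).trans (Finset.sum_le_sum fun i _ => ?_)
    refine (Finset.abs_sum_le_sum_abs _ _).trans (Finset.sum_le_sum fun j _ => ?_)
    rw [abs_mul, abs_of_nonneg (h0 i j), ← mul_add]
    refine mul_le_mul_of_nonneg_left ?_ (h0 i j)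
    rw [abs_le]
    constructor <;> nlinarith [sq_nonneg (u i + v j), sq_nonneg (u i - v j)]
  have c1 : ∑ i, ∑ j, G i j * (u i * u i / 2) ≤ (u ⬝ᵥ u) / 2 := by
    simp only [dotProduct, Finset.sum_div]
    refine Finset.sum_le_sum fun i _ => ?_
    rw [← Finset.sum_mul]
    have := aux_row (G i) (h01 i) (hrow i)
    nlinarith [mul_self_nonneg (u i)]
  have c2 : ∑ i, ∑ j, G i j * (v j * v j / 2) ≤ (v ⬝ᵥ v) / 2 := by
    rw [Finset.sum_comm]
    simp only [dotProduct, Finset.sum_div]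
    refine Finset.sum_le_sum fun j _ => ?_
    rw [← Finset.sum_mul]
    have := aux_row (fun i => G i j) (fun i => h01 i j) (hcol j)
    nlinarith [mul_self_nonneg (v j)]
  simp only [Finset.sum_add_distrib] at b
  linarith

/-- Planner's problem (Appendix A and the paper's Remark): under the doubled-parameter
condition `max(2λ_T‖G_T‖, 2λ_S‖G_S‖) < 1 − |β|`, the aggregate welfare `W` is strictly
concave, the block matrix
`M₂ = fromBlocks (I − 2λ_T G_T) (β G_TS) (β G_ST) (I − 2λ_S G_S)` is invertible, and `W`
attains its unique global maximum at `(t°, s°) = M₂⁻¹ (α^T, α^S)`. -/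
theorem planner_unique_optimum
    (nT nS : ℕ)
    (GT : Matrix (Fin nT) (Fin nT) ℝ) (hGTsym : GT.IsSymm) (hGTpos : ∀ i j, 0 ≤ GT i j)
    (GS : Matrix (Fin nS) (Fin nS) ℝ) (hGSsym : GS.IsSymm) (hGSpos : ∀ i j, 0 ≤ GS i j)
    (GTS : Matrix (Fin nT) (Fin nS) ℝ)
    (hGTS01 : ∀ i j, GTS i j = 0 ∨ GTS i j = 1)
    (hGTSrow : ∀ i, {j | GTS i j ≠ 0}.Subsingleton)
    (hGTScol : ∀ j, {i | GTS i j ≠ 0}.Subsingleton)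
    (lamT lamS beta : ℝ) (hlamT : 0 ≤ lamT) (hlamS : 0 ≤ lamS) (hbeta : |beta| < 1)
    (hnet : max (2 * lamT * l2OpNorm GT) (2 * lamS * l2OpNorm GS) < 1 - |beta|)
    (alphaT : Fin nT → ℝ) (alphaS : Fin nS → ℝ)
    (W : (Fin nT → ℝ) × (Fin nS → ℝ) → ℝ)
    (hW : ∀ p : (Fin nT → ℝ) × (Fin nS → ℝ),
      W p = alphaT ⬝ᵥ p.1 + alphaS ⬝ᵥ p.2 - (1/2) * (p.1 ⬝ᵥ p.1) - (1/2) * (p.2 ⬝ᵥ p.2)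
              - beta * (p.1 ⬝ᵥ (GTS *ᵥ p.2)) + lamT * (p.1 ⬝ᵥ (GT *ᵥ p.1))
              + lamS * (p.2 ⬝ᵥ (GS *ᵥ p.2))) :
    StrictConcaveOn ℝ Set.univ W ∧
    IsUnit (fromBlocks (1 - (2 * lamT) • GT) (beta • GTS) (beta • GTSᵀ)
        (1 - (2 * lamS) • GS)) ∧
    (∀ p : (Fin nT → ℝ) × (Fin nS → ℝ),
        p ≠ ((fun i => ((fromBlocks (1 - (2 * lamT) • GT) (beta • GTS) (beta • GTSᵀ)
                  (1 - (2 * lamS) • GS))⁻¹ *ᵥ Sum.elim alphaT alphaS) (Sum.inl i)),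
             (fun j => ((fromBlocks (1 - (2 * lamT) • GT) (beta • GTS) (beta • GTSᵀ)
                  (1 - (2 * lamS) • GS))⁻¹ *ᵥ Sum.elim alphaT alphaS) (Sum.inr j))) →
        W p < W ((fun i => ((fromBlocks (1 - (2 * lamT) • GT) (beta • GTS) (beta • GTSᵀ)
                  (1 - (2 * lamS) • GS))⁻¹ *ᵥ Sum.elim alphaT alphaS) (Sum.inl i)),
                 (fun j => ((fromBlocks (1 - (2 * lamT) • GT) (beta • GTS) (beta • GTSᵀ)
                  (1 - (2 * lamS) • GS))⁻¹ *ᵥ Sum.elim alphaT alphaS) (Sum.inr j)))) := by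
  have hQ : ∀ (u : Fin nT → ℝ) (v : Fin nS → ℝ), (u ≠ 0 ∨ v ≠ 0) →
      0 < (1/2) * (u ⬝ᵥ u) + (1/2) * (v ⬝ᵥ v) + beta * (u ⬝ᵥ (GTS *ᵥ v))
        - lamT * (u ⬝ᵥ (GT *ᵥ u)) - lamS * (v ⬝ᵥ (GS *ᵥ v)) := by
    intro u v huv
    have h1 := mul_le_mul_of_nonneg_left (aux_norm GT u) hlamT
    have h2 := mul_le_mul_of_nonneg_left (aux_norm GS v) hlamS
    have h3 := aux_cross_s9 GTS hGTS01 hGTSrow hGTScol u v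
    have h4 : -(|beta| * ((u ⬝ᵥ u + v ⬝ᵥ v) / 2)) ≤ beta * (u ⬝ᵥ (GTS *ᵥ v)) := by
      have := mul_le_mul_of_nonneg_left h3 (abs_nonneg beta)
      rw [← abs_mul] at this
      linarith [neg_abs_le (beta * (u ⬝ᵥ (GTS *ᵥ v)))]
    have nT1 := (max_lt_iff.1 hnet).1
    have nS1 := (max_lt_iff.1 hnet).2
    have pu : 0 ≤ u ⬝ᵥ u := Finset.sum_nonneg fun i _ => mul_self_nonneg (u i)
    have pv : 0 ≤ v ⬝ᵥ v := Finset.sum_nonneg fun i _ => mul_self_nonneg (v i)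
    have key : 0 < (1 - |beta| - 2 * lamT * l2OpNorm GT) * (u ⬝ᵥ u)
        + (1 - |beta| - 2 * lamS * l2OpNorm GS) * (v ⬝ᵥ v) := by
      rcases huv with h | h
      · have : 0 < u ⬝ᵥ u := lt_of_le_of_ne pu fun h' => h (dotProduct_self_eq_zero.1 h'.symm)
        exact add_pos_of_pos_of_nonneg (mul_pos (by linarith) this)
          (mul_nonneg (by linarith) pv)
      · have : 0 < v ⬝ᵥ v := lt_of_le_of_ne pv fun h' => h (dotProduct_self_eq_zero.1 h'.symm)
        exact add_pos_of_nonneg_of_pos (mul_nonneg (by linarith) pu)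
          (mul_pos (by linarith) this)
    linarith
  have sT : ∀ x y, x ⬝ᵥ (GT *ᵥ y) = y ⬝ᵥ (GT *ᵥ x) := fun x y => by
    rw [dotProduct_mulVec, ← mulVec_transpose, hGTsym.eq, dotProduct_comm]
  have sS : ∀ x y, x ⬝ᵥ (GS *ᵥ y) = y ⬝ᵥ (GS *ᵥ x) := fun x y => by
    rw [dotProduct_mulVec, ← mulVec_transpose, hGSsym.eq, dotProduct_comm]
  have sTS : ∀ x y, x ⬝ᵥ (GTSᵀ *ᵥ y) = y ⬝ᵥ (GTS *ᵥ x) := fun x y => by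
    rw [mulVec_transpose, dotProduct_comm, ← dotProduct_mulVec]
  set M := fromBlocks (1 - (2 * lamT) • GT) (beta • GTS) (beta • GTSᵀ)
        (1 - (2 * lamS) • GS) with hM
  have hMv : ∀ u v, M *ᵥ Sum.elim u v =
      Sum.elim (u - (2 * lamT) • (GT *ᵥ u) + beta • (GTS *ᵥ v))
        (beta • (GTSᵀ *ᵥ u) + (v - (2 * lamS) • (GS *ᵥ v))) := by
    intro u v
    rw [hM, fromBlocks_mulVec]
    simp [sub_mulVec, smul_mulVec]
  have hU : IsUnit M := by
    rw [← mulVec_injective_iff_isUnit]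
    intro x y hxy
    by_contra hne
    have h0 : M *ᵥ (x - y) = 0 := by rw [mulVec_sub]; exact sub_eq_zero.2 hxy
    obtain ⟨u, v, huv⟩ : ∃ u v, x - y = Sum.elim u v :=
      ⟨(x - y) ∘ Sum.inl, (x - y) ∘ Sum.inr, (Sum.elim_comp_inl_inr _).symm⟩
    have hor : u ≠ 0 ∨ v ≠ 0 := by
      by_contra hc
      push Not at hc
      apply hne
      rw [← sub_eq_zero, huv, hc.1, hc.2]
      ext (i | i) <;> rfl
    rw [huv, hMv] at h0
    have e1 : u - (2 * lamT) • (GT *ᵥ u) + beta • (GTS *ᵥ v) = 0 :=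
      funext fun i => congrFun h0 (Sum.inl i)
    have e2 : beta • (GTSᵀ *ᵥ u) + (v - (2 * lamS) • (GS *ᵥ v)) = 0 :=
      funext fun i => congrFun h0 (Sum.inr i)
    have f1 := congrArg (fun z => u ⬝ᵥ z) e1
    have f2 := congrArg (fun z => v ⬝ᵥ z) e2
    simp only [dotProduct_add, dotProduct_sub, dotProduct_smul, smul_eq_mul,
      dotProduct_zero, sTS] at f1 f2
    have := hQ u v hor
    linarith
  refine ⟨⟨convex_univ, ?_⟩, hU, ?_⟩
  · rintro ⟨x1, x2⟩ - ⟨y1, y2⟩ - hne a b ha hb hab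
    have hor : x1 - y1 ≠ 0 ∨ x2 - y2 ≠ 0 := by
      by_contra hc
      push Not at hc
      exact hne (Prod.ext (sub_eq_zero.1 hc.1) (sub_eq_zero.1 hc.2))
    have q := mul_pos (mul_pos ha hb) (hQ _ _ hor)
    obtain rfl : b = 1 - a := by linarith
    simp only [hW, Prod.smul_mk, Prod.mk_add_mk, smul_eq_mul]
    simp only [dotProduct_add, dotProduct_sub, dotProduct_smul, smul_eq_mul, mulVec_add,
      mulVec_sub, mulVec_smul, add_dotProduct, sub_dotProduct, smul_dotProduct] at q ⊢
    rw [← sub_pos]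
    convert q using 1
    ring
  · intro p hp
    set z := M⁻¹ *ᵥ Sum.elim alphaT alphaS with hz
    set t : Fin nT → ℝ := fun i => z (Sum.inl i) with ht
    set s : Fin nS → ℝ := fun i => z (Sum.inr i) with hs
    have hzts : z = Sum.elim t s := by ext (i | i) <;> rfl
    have hMz : M *ᵥ z = Sum.elim alphaT alphaS := by
      rw [hz, mulVec_mulVec, mul_nonsing_inv _ ((isUnit_iff_isUnit_det _).1 hU), one_mulVec]
    rw [hzts, hMv] at hMz
    have e1 : alphaT = t - (2 * lamT) • (GT *ᵥ t) + beta • (GTS *ᵥ s) :=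
      funext fun i => (congrFun hMz (Sum.inl i)).symm
    have e2 : alphaS = beta • (GTSᵀ *ᵥ t) + (s - (2 * lamS) • (GS *ᵥ s)) :=
      funext fun i => (congrFun hMz (Sum.inr i)).symm
    clear_value t s
    obtain ⟨x, y⟩ := p
    have hor : x - t ≠ 0 ∨ y - s ≠ 0 := by
      by_contra hc
      push Not at hc
      exact hp (Prod.ext (sub_eq_zero.1 hc.1) (sub_eq_zero.1 hc.2))
    have q := hQ _ _ hor
    have a1 : ∀ w, alphaT ⬝ᵥ w = w ⬝ᵥ t - 2 * lamT * (w ⬝ᵥ (GT *ᵥ t))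
        + beta * (w ⬝ᵥ (GTS *ᵥ s)) := fun w => by
      rw [dotProduct_comm, e1]
      simp only [dotProduct_add, dotProduct_sub, dotProduct_smul, smul_eq_mul]
    have a2 : ∀ w, alphaS ⬝ᵥ w = beta * (t ⬝ᵥ (GTS *ᵥ w)) + (w ⬝ᵥ s
        - 2 * lamS * (w ⬝ᵥ (GS *ᵥ s))) := fun w => by
      rw [dotProduct_comm, e2]
      simp only [dotProduct_add, dotProduct_sub, dotProduct_smul, smul_eq_mul, sTS]
    simp only [hW, a1, a2]
    simp only [dotProduct_sub, mulVec_sub, sub_dotProduct] at q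
    rw [sT t x, sS s y, dotProduct_comm t x, dotProduct_comm s y] at q
    rw [← sub_pos]
    convert q using 1
    ring
end
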